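/- Let g₁, …, g_s ∈ ℝ[x₁, …, xₙ] be real polynomials and let U = {x ∈ ℝⁿ : g₁(x) > 0, …, g_s(x) > 0} be the corresponding basic open set. Then for every x ∈ ℝⁿ, 2ˢ·𝟏_U(x) = Σ_{I ⊆ {1,…,s}} sgn( (∏_{i ∈ I} gᵢ(x)) · (∏_{i ∉ I} gᵢ(x)²) ), where the sum runs over all 2ˢ subsets I of {1, …, s}. In particular 2ˢ·𝟏_U is a finite sum of signs of 2ˢ real polynomials. -/

import Mathlib

open MvPolynomial

/-- The sign of a real number, as an integer: 1 if positive, -1 if negative, 0 if zero. -/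
noncomputable def sgn (t : ℝ) : ℤ := if 0 < t then 1 else if t < 0 then -1 else 0

theorem sgn_eq_coe_sign (t : ℝ) : sgn t = (SignType.sign t : ℤ) := by
  rcases lt_trichotomy t 0 with h | rfl | h
  · simp [sgn, h, h.not_gt]
  · simp [sgn]
  · simp [sgn, h]

theorem sgn_mul (a b : ℝ) : sgn (a * b) = sgn a * sgn b := by
  simp [sgn_eq_coe_sign, sign_mul]

theorem sgn_prod {ι : Type*} (t : Finset ι) (f : ι → ℝ) :
    sgn (∏ i ∈ t, f i) = ∏ i ∈ t, sgn (f i) :=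
  map_prod (⟨⟨sgn, by simp [sgn]⟩, sgn_mul⟩ : ℝ →* ℤ) f t

theorem sgn_add_sgn_sq (t : ℝ) : sgn t + sgn (t ^ 2) = 2 * if 0 < t then 1 else 0 := by
  rcases lt_trichotomy t 0 with h | rfl | h
  · simp [sgn, h, h.not_gt, sq_pos_of_neg h]
  · simp [sgn]
  · simp [sgn, h]

theorem two_pow_mul_indicator_basic_open_eq_sum_of_signs
    (n s : ℕ) (g : Fin s → MvPolynomial (Fin n) ℝ)
    (U : Set (Fin n → ℝ)) (hU : U = {x | ∀ i, 0 < eval x (g i)}) (x : Fin n → ℝ) :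
    (2 ^ s : ℤ) * U.indicator (fun _ => (1 : ℤ)) x =
      ∑ I : Finset (Fin s),
        sgn ((∏ i ∈ I, eval x (g i)) * ∏ i ∈ Iᶜ, (eval x (g i)) ^ 2) := by
  have key := Finset.prod_add (fun i => sgn (eval x (g i)))
    (fun i => sgn (eval x (g i) ^ 2)) Finset.univ
  simp only [sgn_add_sgn_sq, Finset.prod_mul_distrib, Finset.prod_const, Finset.card_univ,
    Fintype.card_fin, Finset.powerset_univ, ← Finset.compl_eq_univ_sdiff] at key
  simp only [sgn_mul, sgn_prod]
  subst hU
  convert key using 2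
  simp [Set.indicator_apply, Finset.prod_ite_zero]
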